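/- arXiv:2409.08506 — 2 statements merged into one kernel-verified Lean document; each statement's English description precedes it below -/
import Mathlib

section
/- Quasi-periodicity of the discrete SAFT: let s ∈ ℓ¹(ℤⁿ). Then for every w ∈ ℝⁿ and every l ∈ ℤⁿ, (S s)(w + Bl) = (S s)(w) · exp(iπ[(Bl)ᵀDB⁻¹w + (Bl)ᵀDl + wᵀDl + 2(Qᵀ − PᵀDB⁻¹)Bl]); in particular |(S s)(w + Bl)| = |(S s)(w)|, i.e. |S s| is periodic with periodicity matrix B. -/
open MeasureTheory Matrix Real
open scoped Matrix ComplexConjugate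

noncomputable section

/-- Coercion of an integer lattice point to a real vector. -/
def zc {n : ℕ} (k : Fin n → ℤ) : Fin n → ℝ := fun i => (k i : ℝ)

/-- The chirp `λ(t) = exp(iπ tᵀ B⁻¹ A t)`. -/
def chirp {n : ℕ} (A B : Matrix (Fin n) (Fin n) ℝ) (t : Fin n → ℝ) : ℂ :=
  Complex.exp (Complex.I * (π : ℝ) * ((t ⬝ᵥ ((B⁻¹ * A) *ᵥ t) : ℝ) : ℂ))

/-- The chirp `η(w) = exp(iπ wᵀ D B⁻¹ w + 2iπ(Qᵀ − Pᵀ D B⁻¹) w)`. -/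
def chirpEta {n : ℕ} (B D : Matrix (Fin n) (Fin n) ℝ) (P Q : Fin n → ℝ)
    (w : Fin n → ℝ) : ℂ :=
  Complex.exp (Complex.I * (π : ℝ) * ((w ⬝ᵥ ((D * B⁻¹) *ᵥ w) : ℝ) : ℂ) +
    2 * Complex.I * (π : ℝ) * ((Q ⬝ᵥ w - P ⬝ᵥ ((D * B⁻¹) *ᵥ w) : ℝ) : ℂ))

/-- The n-dimensional special affine Fourier transform. -/
def SAFT {n : ℕ} (A B D : Matrix (Fin n) (Fin n) ℝ) (P Q : Fin n → ℝ)
    (f : (Fin n → ℝ) → ℂ) (w : Fin n → ℝ) : ℂ :=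
  (Real.sqrt |B.det|)⁻¹ * chirpEta B D P Q w *
    ∫ t : Fin n → ℝ, f t * chirp A B t *
      Complex.exp (2 * (π : ℝ) * Complex.I *
        (((B⁻¹ *ᵥ P) ⬝ᵥ t - t ⬝ᵥ (B⁻¹ *ᵥ w) : ℝ) : ℂ))

/-- The discrete (nD-DT) special affine Fourier transform of a sequence on `ℤⁿ`. -/
def dSAFT {n : ℕ} (A B D : Matrix (Fin n) (Fin n) ℝ) (P Q : Fin n → ℝ)
    (s : (Fin n → ℤ) → ℂ) (w : Fin n → ℝ) : ℂ :=
  (Real.sqrt |B.det|)⁻¹ * chirpEta B D P Q w *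
    ∑' k : Fin n → ℤ, s k * chirp A B (zc k) *
      Complex.exp (2 * (π : ℝ) * Complex.I *
        (((B⁻¹ *ᵥ P) ⬝ᵥ zc k - zc k ⬝ᵥ (B⁻¹ *ᵥ w) : ℝ) : ℂ))

/-- The chirped convolution `f *_c g`. -/
def cConv {n : ℕ} (A B : Matrix (Fin n) (Fin n) ℝ)
    (f g : (Fin n → ℝ) → ℂ) (t : Fin n → ℝ) : ℂ :=
  (conj (chirp A B t) / (Real.sqrt |B.det| : ℂ)) *
    ∫ x : Fin n → ℝ, f (t - x) * chirp A B (t - x) * (g x * chirp A B x)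

/-- The semi-discrete chirped convolution `s *_sd φ`. -/
def sdConv {n : ℕ} (A B : Matrix (Fin n) (Fin n) ℝ)
    (s : (Fin n → ℤ) → ℂ) (φ : (Fin n → ℝ) → ℂ) (t : Fin n → ℝ) : ℂ :=
  (conj (chirp A B t) / (Real.sqrt |B.det| : ℂ)) *
    ∑' k : Fin n → ℤ, s k * chirp A B (zc k) * (φ (t - zc k) * chirp A B (t - zc k))

/-- The discrete chirped convolution `s *_d c`. -/
def dConv {n : ℕ} (A B : Matrix (Fin n) (Fin n) ℝ)
    (s c : (Fin n → ℤ) → ℂ) (l : Fin n → ℤ) : ℂ :=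
  (conj (chirp A B (zc l)) / (Real.sqrt |B.det| : ℂ)) *
    ∑' k : Fin n → ℤ, s k * chirp A B (zc k) * (c (l - k) * chirp A B (zc (l - k)))


theorem zc_dotProduct_zc {n : ℕ} (k l : Fin n → ℤ) : zc k ⬝ᵥ zc l = ((k ⬝ᵥ l : ℤ) : ℝ) := by
  simp [zc, dotProduct]

/-- The kernel of the discrete SAFT is `B`-periodic in the frequency variable. -/
theorem exp_kernel_add_mulVec_zc {n : ℕ} {B : Matrix (Fin n) (Fin n) ℝ} (hB : IsUnit B.det)
    (c : ℝ) (w : Fin n → ℝ) (k l : Fin n → ℤ) :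
    Complex.exp (2 * (π : ℝ) * Complex.I *
        ((c - zc k ⬝ᵥ (B⁻¹ *ᵥ (w + B *ᵥ zc l)) : ℝ) : ℂ)) =
      Complex.exp (2 * (π : ℝ) * Complex.I * ((c - zc k ⬝ᵥ (B⁻¹ *ᵥ w) : ℝ) : ℂ)) := by
  rw [Complex.exp_eq_exp_iff_exists_int]
  refine ⟨-(k ⬝ᵥ l), ?_⟩
  rw [mulVec_add, mulVec_mulVec, nonsing_inv_mul _ hB, one_mulVec, dotProduct_add,
    zc_dotProduct_zc]
  push_cast
  ring

theorem chirpEta_add_mulVec {n : ℕ} {B : Matrix (Fin n) (Fin n) ℝ} (hB : IsUnit B.det)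
    (D : Matrix (Fin n) (Fin n) ℝ) (P Q w x : Fin n → ℝ) :
    chirpEta B D P Q (w + B *ᵥ x) =
      chirpEta B D P Q w *
        Complex.exp (Complex.I * (π : ℝ) *
          (((B *ᵥ x) ⬝ᵥ ((D * B⁻¹) *ᵥ w) + (B *ᵥ x) ⬝ᵥ (D *ᵥ x) + w ⬝ᵥ (D *ᵥ x)
            + 2 * (Q ⬝ᵥ (B *ᵥ x) - P ⬝ᵥ ((D * B⁻¹) *ᵥ (B *ᵥ x))) : ℝ) : ℂ)) := by
  have hD : (D * B⁻¹) *ᵥ (B *ᵥ x) = D *ᵥ x := by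
    rw [mulVec_mulVec, Matrix.mul_assoc, nonsing_inv_mul _ hB, Matrix.mul_one]
  simp only [chirpEta, ← Complex.exp_add, mulVec_add, hD, dotProduct_add, add_dotProduct]
  congr 1
  push_cast
  ring

/-- **Quasi-periodicity of the discrete SAFT**: `|S s|` is periodic with
periodicity matrix `B`. -/
theorem dsaft_quasi_periodic {n : ℕ} (hn : 1 ≤ n)
    (A B C D : Matrix (Fin n) (Fin n) ℝ) (P Q : Fin n → ℝ)
    (hB : IsUnit B.det)
    (hAB : A * Bᵀ = B * Aᵀ) (hCD : C * Dᵀ = D * Cᵀ) (hADBC : A * Dᵀ - B * Cᵀ = 1)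
    (s : (Fin n → ℤ) → ℂ) (hs : Summable (fun k => ‖s k‖))
    (w : Fin n → ℝ) (l : Fin n → ℤ) :
    dSAFT A B D P Q s (w + B *ᵥ zc l) =
      dSAFT A B D P Q s w *
        Complex.exp (Complex.I * (π : ℝ) *
          (((B *ᵥ zc l) ⬝ᵥ ((D * B⁻¹) *ᵥ w) + (B *ᵥ zc l) ⬝ᵥ (D *ᵥ zc l)
            + w ⬝ᵥ (D *ᵥ zc l)
            + 2 * (Q ⬝ᵥ (B *ᵥ zc l) - P ⬝ᵥ ((D * B⁻¹) *ᵥ (B *ᵥ zc l))) : ℝ) : ℂ)) ∧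
    ‖dSAFT A B D P Q s (w + B *ᵥ zc l)‖ = ‖dSAFT A B D P Q s w‖ := by
  have key := chirpEta_add_mulVec hB D P Q w (zc l)
  refine (and_iff_left_of_imp fun h => ?_).mpr ?_
  · rw [h, norm_mul, mul_assoc Complex.I, ← Complex.ofReal_mul, Complex.norm_exp_I_mul_ofReal,
      mul_one]
  · simp only [dSAFT, exp_kernel_add_mulVec_zc hB, key]
    ring

end
end

section
/- Discrete convolution theorem for the n-dimensional SAFT: let s, c ∈ ℓ¹(ℤⁿ) ∩ ℓ²(ℤⁿ) and h = s *_d c. Then for every w ∈ ℝⁿ, (S h)(w) = conj(η(w)) · (S s)(w) · (S c)(w). -/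
open MeasureTheory Matrix Real
open scoped Matrix ComplexConjugate

noncomputable section

/-- Cauchy product of two absolutely summable families indexed by an additive commutative group. -/
theorem tsum_tsum_mul_sub {G : Type*} [AddCommGroup G] {f g : G → ℂ}
    (hf : Summable (fun k => ‖f k‖)) (hg : Summable (fun k => ‖g k‖)) :
    ∑' l, ∑' k, f k * g (l - k) = (∑' k, f k) * ∑' k, g k := by
  let e : G × G ≃ G × G :=
    { toFun := fun p => (p.2, p.1 - p.2)
      invFun := fun p => (p.1 + p.2, p.1)
      left_inv := fun p => by simp
      right_inv := fun p => by simp }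
  have hsum : Summable fun p : G × G => f p.1 * g p.2 := summable_mul_of_summable_norm hf hg
  have hsum' : Summable fun p : G × G => f p.2 * g (p.1 - p.2) := e.summable_iff.mpr hsum
  rw [tsum_mul_tsum_of_summable_norm hf hg, ← e.tsum_eq]
  exact hsum'.tsum_prod.symm

theorem norm_chirp {n : ℕ} (A B : Matrix (Fin n) (Fin n) ℝ) (t : Fin n → ℝ) :
    ‖chirp A B t‖ = 1 := by
  simp [chirp, Complex.norm_exp]

theorem norm_chirpEta {n : ℕ} (B D : Matrix (Fin n) (Fin n) ℝ) (P Q w : Fin n → ℝ) :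
    ‖chirpEta B D P Q w‖ = 1 := by
  rw [chirpEta, Complex.norm_exp, Real.exp_eq_one_iff]
  simp only [Complex.add_re, Complex.mul_re, Complex.mul_im]
  simp

/-- The character `k ↦ exp(2πi((B⁻¹P)ᵀk − kᵀB⁻¹w))` in the kernel of the discrete SAFT. -/
def saftPhase {n : ℕ} (B : Matrix (Fin n) (Fin n) ℝ) (P w : Fin n → ℝ) (k : Fin n → ℤ) : ℂ :=
  Complex.exp (2 * (π : ℝ) * Complex.I *
    (((B⁻¹ *ᵥ P) ⬝ᵥ zc k - zc k ⬝ᵥ (B⁻¹ *ᵥ w) : ℝ) : ℂ))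

theorem norm_saftPhase {n : ℕ} (B : Matrix (Fin n) (Fin n) ℝ) (P w : Fin n → ℝ)
    (k : Fin n → ℤ) : ‖saftPhase B P w k‖ = 1 := by
  rw [saftPhase, Complex.norm_exp, Real.exp_eq_one_iff, Complex.re_mul_ofReal]
  simp

theorem zc_sub {n : ℕ} (k l : Fin n → ℤ) : zc (k - l) = zc k - zc l := by
  ext i
  simp [zc]

theorem saftPhase_mul_sub {n : ℕ} (B : Matrix (Fin n) (Fin n) ℝ) (P w : Fin n → ℝ)
    (k l : Fin n → ℤ) :
    saftPhase B P w k * saftPhase B P w (l - k) = saftPhase B P w l := by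
  rw [saftPhase, saftPhase, saftPhase, ← Complex.exp_add, zc_sub, dotProduct_sub, sub_dotProduct]
  congr 1
  push_cast
  ring

theorem conj_mul_self_of_norm_eq_one {z : ℂ} (hz : ‖z‖ = 1) : conj z * z = 1 := by
  simp [Complex.conj_mul', hz]

/-- Modulating the discrete chirped convolution gives the ordinary convolution of the modulated
sequences. -/
theorem dConv_mul_chirp_mul_saftPhase {n : ℕ} (A B : Matrix (Fin n) (Fin n) ℝ)
    (P w : Fin n → ℝ) (s c : (Fin n → ℤ) → ℂ) (l : Fin n → ℤ) :
    dConv A B s c l * chirp A B (zc l) * saftPhase B P w l =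
      (Real.sqrt |B.det| : ℂ)⁻¹ * ∑' k, s k * chirp A B (zc k) * saftPhase B P w k *
        (c (l - k) * chirp A B (zc (l - k)) * saftPhase B P w (l - k)) := by
  have hterm : ∀ k, s k * chirp A B (zc k) * saftPhase B P w k *
      (c (l - k) * chirp A B (zc (l - k)) * saftPhase B P w (l - k)) =
      s k * chirp A B (zc k) * (c (l - k) * chirp A B (zc (l - k))) * saftPhase B P w l := by
    intro k
    rw [← saftPhase_mul_sub B P w k l]
    ring
  simp_rw [hterm]
  rw [tsum_mul_right, dConv]
  linear_combination ((Real.sqrt |B.det| : ℂ)⁻¹ *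
    (∑' k, s k * chirp A B (zc k) * (c (l - k) * chirp A B (zc (l - k)))) *
    saftPhase B P w l) * conj_mul_self_of_norm_eq_one (norm_chirp A B (zc l))

theorem summable_norm_mul_chirp_mul_saftPhase {n : ℕ} (A B : Matrix (Fin n) (Fin n) ℝ)
    (P w : Fin n → ℝ) {s : (Fin n → ℤ) → ℂ} (hs : Summable fun k => ‖s k‖) :
    Summable fun k => ‖s k * chirp A B (zc k) * saftPhase B P w k‖ := by
  simpa [norm_chirp, norm_saftPhase] using hs

/-- **Discrete convolution theorem for the n-dimensional SAFT.** -/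
theorem dsaft_discrete_convolution {n : ℕ} (hn : 1 ≤ n)
    (A B C D : Matrix (Fin n) (Fin n) ℝ) (P Q : Fin n → ℝ)
    (hB : IsUnit B.det)
    (hAB : A * Bᵀ = B * Aᵀ) (hCD : C * Dᵀ = D * Cᵀ) (hADBC : A * Dᵀ - B * Cᵀ = 1)
    (s c : (Fin n → ℤ) → ℂ)
    (hs1 : Summable (fun k => ‖s k‖)) (hs2 : Summable (fun k => ‖s k‖ ^ 2))
    (hc1 : Summable (fun k => ‖c k‖)) (hc2 : Summable (fun k => ‖c k‖ ^ 2))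
    (h : (Fin n → ℤ) → ℂ) (hh : h = dConv A B s c) (w : Fin n → ℝ) :
    dSAFT A B D P Q h w =
      conj (chirpEta B D P Q w) * dSAFT A B D P Q s w * dSAFT A B D P Q c w := by
  subst hh
  have hS : ∀ u : (Fin n → ℤ) → ℂ, dSAFT A B D P Q u w =
      (Real.sqrt |B.det| : ℂ)⁻¹ * chirpEta B D P Q w *
        ∑' k, u k * chirp A B (zc k) * saftPhase B P w k := by
    intro u
    simp [dSAFT, saftPhase]
  rw [hS, hS, hS]
  simp_rw [dConv_mul_chirp_mul_saftPhase]
  rw [tsum_mul_left, tsum_tsum_mul_sub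
    (f := fun k => s k * chirp A B (zc k) * saftPhase B P w k)
    (g := fun k => c k * chirp A B (zc k) * saftPhase B P w k)
    (summable_norm_mul_chirp_mul_saftPhase A B P w hs1)
    (summable_norm_mul_chirp_mul_saftPhase A B P w hc1)]
  linear_combination (-(Real.sqrt |B.det| : ℂ)⁻¹ * (Real.sqrt |B.det| : ℂ)⁻¹ *
    chirpEta B D P Q w * (∑' k, s k * chirp A B (zc k) * saftPhase B P w k) *
    (∑' k, c k * chirp A B (zc k) * saftPhase B P w k)) *
    conj_mul_self_of_norm_eq_one (norm_chirpEta B D P Q w)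

end
end
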